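/- Let X be an infinite set of cardinality κ = ℵ_α and let λ = max(|α|, ℵ₀). Then the number of submonoids of the full transformation monoid O^(1) which contain all permutations of X is exactly 2^(2^λ). -/

import Mathlib

open Cardinal

universe u

/-- The submonoid of all permutations inside the full transformation monoid `Function.End X`. -/
def permSubmonoid (X : Type u) : Submonoid (Function.End X) where
  carrier := {f | Function.Bijective f}
  mul_mem' hf hg := hf.comp hg
  one_mem' := Function.bijective_id

/-- A submonoid `C ≠ O⁽¹⁾` is precomplete iff together with any function outside of it,
it generates the full transformation monoid. -/
def Precomplete {X : Type u} (C : Submonoid (Function.End X)) : Prop :=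
  C ≠ ⊤ ∧ ∀ f : Function.End X, f ∉ C →
    Submonoid.closure ((C : Set (Function.End X)) ∪ {f}) = ⊤

/-- `f` is `ξ`-injective: `f` is injective off a set of cardinality `< ξ`. -/
def XiInjective {X : Type u} (ξ : Cardinal.{u}) (f : Function.End X) : Prop :=
  ∃ Y : Set X, #Y < ξ ∧ Set.InjOn f Yᶜ

/-- `f` is `ξ`-surjective: the complement of its range has cardinality `< ξ`. -/
def XiSurjective {X : Type u} (ξ : Cardinal.{u}) (f : Function.End X) : Prop :=
  #((Set.range f)ᶜ : Set X) < ξ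

/-- The set `A` of functions almost all of whose fibers are small. -/
def monA (X : Type u) : Set (Function.End X) :=
  {f | #{y : X | ¬ #(f ⁻¹' {y}) < #X} < #X}

/-- The set `A'` of functions `f` such that for some `ξ < |X|`, almost all fibers of `f`
have cardinality at most `ξ`. -/
def monA' (X : Type u) : Set (Function.End X) :=
  {f | ∃ ξ : Cardinal.{u}, ξ < #X ∧ #{x : X | ¬ #(f ⁻¹' {x}) ≤ ξ} < #X}

/-- The set `G_ξ` of functions which are `ξ`-injective or not `ξ`-surjective. -/
def monG (X : Type u) (ξ : Cardinal.{u}) : Set (Function.End X) :=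
  {f | XiInjective ξ f ∨ ¬ XiSurjective ξ f}

/-- The set `M_ξ` of functions which are `ξ`-surjective or not `ξ`-injective. -/
def monM (X : Type u) (ξ : Cardinal.{u}) : Set (Function.End X) :=
  {f | XiSurjective ξ f ∨ ¬ XiInjective ξ f}

/-- The kernel sequence of `f` assigns to every cardinal `ξ` the number of
(nonempty) fibers of `f` of cardinality `ξ`. -/
noncomputable def kernelSeq {X : Type u} (f : X → X) (ξ : Cardinal.{u}) : Cardinal.{u} :=
  #{A : Set X // (∃ y : X, A = f ⁻¹' {y}) ∧ A.Nonempty ∧ #A = ξ}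

/-- The set `R`: the range of the sequence `(n i)` together with all infinite
successor cardinals `≤ κ`. -/
def setR (κ : Cardinal.{u}) (n : ℕ → ℕ) : Set Cardinal.{u} :=
  (Set.range fun i : ℕ => (n i : Cardinal.{u})) ∪
    {ξ | ℵ₀ ≤ ξ ∧ ξ ≤ κ ∧ ∃ μ : Cardinal.{u}, ξ = Order.succ μ}

/-- The sum of a set of cardinals. -/
noncomputable def setSum (A : Set Cardinal.{u}) : Cardinal.{u + 1} :=
  Cardinal.sum fun η : A => (η : Cardinal.{u})

/-- A type of cardinality `max α.card ℵ₀` that indexes cardinals at most `ℵ_α`. -/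
abbrev CardIndex (α : Ordinal.{u}) : Type u := ULift.{u} ℕ ⊕ α.ToType

theorem mk_cardIndex (α : Ordinal.{u}) : #(CardIndex α) = max α.card ℵ₀ := by
  rw [CardIndex, mk_sum, mk_uLift, mk_nat, lift_aleph0, lift_aleph0, lift_id, mk_toType,
    add_eq_max le_rfl, max_comm]

/-- An enumeration of cardinals in `[3, ℵ_α)`. -/
noncomputable def indexedCard (α : Ordinal.{u}) : CardIndex α → Cardinal.{u}
  | Sum.inl n => (n.down + 3 : ℕ)
  | Sum.inr b => aleph (Ordinal.ToType.toOrd b)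

theorem indexedCard_injective (α : Ordinal.{u}) : Function.Injective (indexedCard α) := by
  rintro (m | a) (n | b) h
  · have hmn : m.down + 3 = n.down + 3 := Nat.cast_injective (R := Cardinal.{u}) h
    exact congrArg Sum.inl (ULift.ext _ _ (Nat.add_right_cancel hmn))
  · exact absurd h ((natCast_lt_aleph0.trans_le (aleph0_le_aleph _)).ne)
  · exact absurd h.symm ((natCast_lt_aleph0.trans_le (aleph0_le_aleph _)).ne)
  · rw [Ordinal.ToType.mk.symm.injective (Subtype.ext (aleph.injective h))]

theorem two_lt_indexedCard {α : Ordinal.{u}} (j : CardIndex α) : 2 < indexedCard α j := by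
  rcases j with n | b
  · exact Nat.cast_lt (α := Cardinal.{u}).2 (show 2 < n.down + 3 by lia)
  · exact (natCast_lt_aleph0 (n := 2)).trans_le (aleph0_le_aleph _)

theorem indexedCard_le {α : Ordinal.{u}} (j : CardIndex α) : indexedCard α j ≤ aleph α := by
  rcases j with n | b
  · exact natCast_lt_aleph0.le.trans (aleph0_le_aleph _)
  · exact aleph.monotone (Ordinal.ToType.toOrd b).2.le

theorem exists_cover_Iic_aleph (α : Ordinal.{u}) :
    ∃ d : Option (CardIndex α) → Cardinal.{u}, Set.Iic (aleph α) ⊆ Set.range d := by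
  refine ⟨fun k => k.elim (aleph α) (Sum.elim (fun n => (n.down : Cardinal))
    (fun b => aleph (Ordinal.ToType.toOrd b))), fun c hc => ?_⟩
  rcases lt_or_ge c ℵ₀ with h | h
  · obtain ⟨n, rfl⟩ := lt_aleph0.1 h
    exact ⟨some (Sum.inl ⟨n⟩), rfl⟩
  · obtain ⟨o, rfl⟩ := mem_range_aleph_iff.2 h
    rcases (aleph_le_aleph.1 hc).lt_or_eq with ho | rfl
    · exact ⟨some (Sum.inr (Ordinal.ToType.mk ⟨o, ho⟩)), by simp⟩
    · exact ⟨none, rfl⟩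

/-- Two self-maps with the same number of fibers of each cardinality differ by permutations. -/
theorem exists_equiv_comp_of_fiber_card {X : Type u} {f g : X → X}
    (h : ∀ c : Cardinal.{u}, #{y | #(f ⁻¹' {y}) = c} = #{y | #(g ⁻¹' {y}) = c}) :
    ∃ σ τ : Equiv.Perm X, g = σ ∘ f ∘ τ := by
  have h1 : ∀ c, Nonempty ({y // #(f ⁻¹' {y}) = c} ≃ {y // #(g ⁻¹' {y}) = c}) :=
    fun c => Cardinal.eq.1 (h c)
  let σ : X ≃ X := Equiv.ofFiberEquiv fun c => (h1 c).some
  have hσ : ∀ y, #(g ⁻¹' {σ y}) = #(f ⁻¹' {y}) :=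
    fun y => Equiv.ofFiberEquiv_map (fun c => (h1 c).some) y
  have h2 : ∀ y, Nonempty ({x // g x = y} ≃ {x // (σ ∘ f) x = y}) := by
    intro y
    obtain ⟨z, rfl⟩ := σ.surjective y
    refine Cardinal.eq.1 ((hσ z).trans ?_)
    exact mk_congr (Equiv.subtypeEquivRight fun x => by simp)
  exact ⟨σ, Equiv.ofFiberEquiv fun y => (h2 y).some,
    funext fun x => (Equiv.ofFiberEquiv_map (fun y => (h2 y).some) x).symm⟩

/-- The set of cardinalities of the fibers of `f`. -/
def fiberCards {X : Type u} (f : X → X) : Set Cardinal.{u} :=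
  Set.range fun y => #(f ⁻¹' {y})

theorem fiberCards_comp_bijective {X : Type u} (f : X → X) {g : X → X}
    (hg : Function.Bijective g) : fiberCards (f ∘ g) = fiberCards f := by
  refine congrArg Set.range (funext fun y => ?_)
  rw [Set.preimage_comp]
  exact mk_preimage_of_injective_of_subset_range g _ hg.1 (by simp [hg.2.range_eq])

theorem fiberCards_bijective_comp {X : Type u} (f : X → X) {g : X → X}
    (hg : Function.Bijective g) : fiberCards (g ∘ f) = fiberCards f := by
  rw [fiberCards, ← hg.2.range_comp]
  refine congrArg Set.range (funext fun y => ?_)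
  have : g ⁻¹' {g y} = {y} := by ext x; simp [hg.1.eq_iff]
  simp only [Function.comp_apply]
  rw [Set.preimage_comp, this]

theorem four_le_mk_fiber_comp {X : Type u} {f g : X → X} (hf : ∀ c ∈ fiberCards f, 2 ≤ c)
    (hg : ∀ c ∈ fiberCards g, 2 ≤ c) : ∀ c ∈ fiberCards (f ∘ g), 4 ≤ c := by
  rintro _ ⟨y, rfl⟩
  obtain ⟨⟨a, ha⟩, ⟨b, hb⟩, hab⟩ := two_le_iff.1 (hf _ ⟨y, rfl⟩)
  have hab' : a ≠ b := fun h => hab (Subtype.ext h)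
  have hd : Disjoint (g ⁻¹' {a}) (g ⁻¹' {b}) :=
    Disjoint.preimage g (Set.disjoint_singleton.2 hab')
  calc (4 : Cardinal) = 2 + 2 := by norm_num
    _ ≤ #(g ⁻¹' {a}) + #(g ⁻¹' {b}) := add_le_add (hg _ ⟨a, rfl⟩) (hg _ ⟨b, rfl⟩)
    _ = #(g ⁻¹' {a} ∪ g ⁻¹' {b} : Set X) := (mk_union_of_disjoint hd).symm
    _ ≤ #((f ∘ g) ⁻¹' {y}) := by
      refine mk_le_mk_of_subset ?_
      rintro x (hx | hx)
      · rw [Set.mem_preimage, Set.mem_singleton_iff] at hx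
        simpa [hx] using ha
      · rw [Set.mem_preimage, Set.mem_singleton_iff] at hx
        simpa [hx] using hb

/-- The monoid of all permutations and all functions `f` with fibers of cardinality at least `2`
such that, if some fiber has exactly two elements, the set of fiber cardinalities is in `T`. -/
def fiberMonoid (X : Type u) (T : Set (Set Cardinal.{u})) : Submonoid (Function.End X) where
  carrier := {f | Function.Bijective f ∨
    (∀ c ∈ fiberCards f, 2 ≤ c) ∧ (2 ∈ fiberCards f → fiberCards f ∈ T)}
  one_mem' := Or.inl Function.bijective_id
  mul_mem' := by
    rintro f g (hf | hf) (hg | hg)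
    · exact Or.inl (hf.comp hg)
    · refine Or.inr ?_
      change (∀ c ∈ fiberCards (f ∘ g), _) ∧ (2 ∈ fiberCards (f ∘ g) → fiberCards (f ∘ g) ∈ T)
      rwa [fiberCards_bijective_comp g hf]
    · refine Or.inr ?_
      change (∀ c ∈ fiberCards (f ∘ g), _) ∧ (2 ∈ fiberCards (f ∘ g) → fiberCards (f ∘ g) ∈ T)
      rwa [fiberCards_comp_bijective f hg]
    · have h4 := four_le_mk_fiber_comp hf.1 hg.1
      have h24 : (2 : Cardinal.{u}) < 4 := by exact_mod_cast (show 2 < 4 by omega)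
      exact Or.inr ⟨fun c hc => h24.le.trans (h4 c hc),
        fun h => absurd (h4 2 h) h24.not_ge⟩

theorem permSubmonoid_le_fiberMonoid (X : Type u) (T : Set (Set Cardinal.{u})) :
    permSubmonoid X ≤ fiberMonoid X T :=
  fun _ hf => Or.inl hf

theorem mem_fiberMonoid_iff {X : Type u} [Nonempty X] {T : Set (Set Cardinal.{u})}
    {f : Function.End X} (h : ∀ c ∈ fiberCards f, 2 ≤ c) (h2 : 2 ∈ fiberCards f) :
    f ∈ fiberMonoid X T ↔ fiberCards f ∈ T := by
  refine ⟨?_, fun hT => Or.inr ⟨h, fun _ => hT⟩⟩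
  rintro (hf | hf)
  · obtain ⟨y⟩ := ‹Nonempty X›
    obtain ⟨a, b, hab⟩ := two_le_iff.1 (h _ ⟨y, rfl⟩)
    exact absurd (Subtype.ext (hf.1 (a.2.trans b.2.symm))) hab
  · exact hf.2 h2

theorem exists_fiber_card_eq {X : Type u} [Infinite X] (s : X → Cardinal.{u})
    (h1 : ∀ x, 1 ≤ s x) (hs : ∀ x, s x ≤ #X) : ∃ f : X → X, ∀ x, #(f ⁻¹' {x}) = s x := by
  have hP : #X = #(Σ x, (s x).out) := by
    rw [mk_sigma]
    simp only [mk_out]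
    apply le_antisymm
    · calc #X = sum fun _ : X => (1 : Cardinal.{u}) := by simp
        _ ≤ sum s := sum_le_sum _ _ h1
    · calc sum s ≤ sum fun _ : X => #X := sum_le_sum _ _ hs
        _ = #X := by simp [mul_eq_self (aleph0_le_mk X)]
  obtain ⟨e⟩ := Cardinal.eq.1 hP
  refine ⟨fun x => (e x).1, fun x => ?_⟩
  rw [← mk_out (s x)]
  refine mk_congr ((e.subtypeEquiv (q := fun p => p.1 = x) fun a => Iff.rfl).trans ?_)
  exact Equiv.sigmaSubtype x

theorem exists_fiberCards_eq {X : Type u} [Infinite X] {S : Set Cardinal.{u}}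
    {ι : Type u} (c : ι → Cardinal.{u}) (hc : Set.range c = S) (hι : #ι ≤ #X)
    (hS : S.Nonempty) (h1 : ∀ c ∈ S, 1 ≤ c) (hle : ∀ c ∈ S, c ≤ #X) :
    ∃ f : X → X, fiberCards f = S := by
  subst hc
  have : Nonempty ι := Set.range_nonempty_iff_nonempty.1 hS
  obtain ⟨⟨i, hi⟩⟩ := hι
  obtain ⟨f, hf⟩ := exists_fiber_card_eq (fun x => c (Function.invFun i x))
    (fun x => h1 _ ⟨_, rfl⟩) (fun x => hle _ ⟨_, rfl⟩)
  refine ⟨f, ?_⟩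
  simp only [fiberCards, hf]
  exact (Function.invFun_surjective hi).range_comp c

theorem card_le_aleph (α : Ordinal.{u}) : α.card ≤ aleph α := by
  rw [← ord_le_ord]
  exact (ord_card_le α).trans ((Ordinal.le_omega_self α).trans (ord_aleph α).ge)

theorem le_card_monoids_above_S {X : Type u} [Infinite X] {α : Ordinal.{u}}
    (hκ : #X = aleph α) :
    #(Set (Set (CardIndex α))) ≤
      #{M : Submonoid (Function.End X) // permSubmonoid X ≤ M} := by
  let E : Set (CardIndex α) → Set Cardinal.{u} := fun A => insert 2 (indexedCard α '' A)
  have hE : Function.Injective E := by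
    intro A B h
    ext j
    have key : ∀ A : Set (CardIndex α), j ∈ A ↔ indexedCard α j ∈ E A := fun A => by
      simp [E, (two_lt_indexedCard j).ne', (indexedCard_injective α).eq_iff]
    rw [key A, key B, h]
  have h2 : (2 : Cardinal.{u}) ≤ #X := (natCast_lt_aleph0 (n := 2)).le.trans (aleph0_le_mk X)
  have hf : ∀ A, ∃ f : X → X, fiberCards f = E A := by
    intro A
    have hcard : #(Option A) ≤ #X := by
      rw [mk_option]
      refine add_le_of_le (aleph0_le_mk X) ?_ (one_le_aleph0.trans (aleph0_le_mk X))
      refine (mk_set_le A).trans ?_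
      rw [mk_cardIndex, hκ]
      exact max_le (card_le_aleph α) (aleph0_le_aleph α)
    refine exists_fiberCards_eq (fun o : Option A => o.elim 2 fun j => indexedCard α j) ?_ hcard
      ⟨2, Set.mem_insert _ _⟩ ?_ ?_
    · ext c
      simp [E, Option.exists, eq_comm]
    · rintro _ (rfl | ⟨j, _, rfl⟩)
      · exact one_le_two
      · exact one_le_two.trans (two_lt_indexedCard j).le
    · rintro _ (rfl | ⟨j, _, rfl⟩)
      · exact h2
      · exact hκ ▸ indexedCard_le j
  refine mk_le_of_injective (f := fun T =>
    ⟨fiberMonoid X (E '' T), permSubmonoid_le_fiberMonoid X _⟩) ?_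
  intro T U h
  have h' : fiberMonoid X (E '' T) = fiberMonoid X (E '' U) := congrArg Subtype.val h
  ext A
  obtain ⟨(f : Function.End X), hfA⟩ := hf A
  have key : ∀ T : Set (Set (CardIndex α)),
      A ∈ T ↔ f ∈ fiberMonoid X (E '' T) := by
    intro T
    refine Iff.symm ((mem_fiberMonoid_iff ?_ ?_).trans ?_)
    · rw [hfA]
      rintro _ (rfl | ⟨j, _, rfl⟩)
      · exact le_rfl
      · exact (two_lt_indexedCard j).le
    · rw [hfA]
      exact Set.mem_insert _ _
    · rw [hfA, hE.mem_set_image]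
  rw [key T, key U, h']

theorem card_monoids_above_S_le {X : Type u} {α : Ordinal.{u}} (hκ : #X = aleph α) :
    #{M : Submonoid (Function.End X) // permSubmonoid X ≤ M} ≤
      #(Set (Option (CardIndex α) → Option (CardIndex α))) := by
  obtain ⟨d, hd⟩ := exists_cover_Iic_aleph α
  have hd' : ∀ s : Set X, ∃ k, d k = #s := fun s => hd (hκ ▸ mk_set_le s)
  choose r hr using hd'
  let t : Function.End X → Option (CardIndex α) → Option (CardIndex α) :=
    fun f k => r {y | #(f ⁻¹' {y}) = d k}
  have ht : ∀ f g, t f = t g → ∃ σ τ : Equiv.Perm X, g = σ ∘ f ∘ τ := by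
    intro f g h
    refine exists_equiv_comp_of_fiber_card fun c => ?_
    by_cases hc : c ≤ #X
    · obtain ⟨k, rfl⟩ := hd (hκ ▸ hc : c ∈ Set.Iic (aleph α))
      rw [← hr, ← hr]
      exact congrArg d (congrFun h k)
    · have key : ∀ f : X → X, {y | #(f ⁻¹' {y}) = c} = ∅ := fun f =>
        Set.eq_empty_of_forall_notMem fun y hy => hc (hy ▸ mk_set_le _)
      rw [key f, key g]
  refine mk_le_of_injective (f := fun M => t '' (M.1 : Set (Function.End X))) ?_
  have key : ∀ M N : {M : Submonoid (Function.End X) // permSubmonoid X ≤ M},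
      t '' (M.1 : Set (Function.End X)) ⊆ t '' (N.1 : Set (Function.End X)) → M.1 ≤ N.1 := by
    intro M N h f hfM
    obtain ⟨g, hg, hgf⟩ := h ⟨f, hfM, rfl⟩
    obtain ⟨σ, τ, rfl⟩ := ht g f hgf
    exact N.1.mul_mem (N.2 σ.bijective) (N.1.mul_mem hg (N.2 τ.bijective))
  exact fun M N h => Subtype.ext (le_antisymm (key M N h.subset) (key N M h.superset))

/-- On an infinite set of cardinality `ℵ_α`, there are exactly `2^(2^λ)` submonoids of the
full transformation monoid containing all permutations, where `λ = max(|α|, ℵ₀)`. -/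
theorem card_monoids_above_S {X : Type u} [Infinite X] {α : Ordinal.{u}}
    (hκ : #X = Cardinal.aleph α) (lam : Cardinal.{u}) (hlam : lam = max α.card ℵ₀) :
    #{M : Submonoid (Function.End X) // permSubmonoid X ≤ M} = (2 : Cardinal.{u}) ^ ((2 : Cardinal.{u}) ^ lam) := by
  have hJ : #(CardIndex α) = lam := (mk_cardIndex α).trans hlam.symm
  have hlam₀ : ℵ₀ ≤ lam := hlam ▸ le_max_right _ _
  have hK : #(Option (CardIndex α)) = lam := by
    rw [mk_option, hJ, add_one_eq hlam₀]
  apply le_antisymm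
  · refine (card_monoids_above_S_le hκ).trans_eq ?_
    rw [mk_set, ← power_def, hK, power_self_eq hlam₀]
  · refine Eq.trans_le ?_ (le_card_monoids_above_S hκ)
    rw [mk_set, mk_set, hJ]
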